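/- arXiv:2604.15691 — 8 statements merged into one kernel-verified Lean document; each statement's English description precedes it below -/
import Mathlib

section
/- A polynomial P ∈ R, with a_{I,J,K} denoting the coefficient of the monomial x^I y^J z^K of P (for multi-indices I,J,K ∈ ℕ^N), vanishes at every point of V_ε if and only if for all multi-indices I, T ∈ ℕ^N the three families of linear equations hold: Σ_{J ≤ T} ε^J · a_{I,J,T−J} = 0, Σ_{J ≤ T} ε^J · a_{J,T−J,I} = 0, and Σ_{J ≤ T} ε^J · a_{T−J,I,J} = 0, where the sums range over multi-indices J with J_i ≤ T_i for all i, and ε^J = ∏_{i=1}^N ε_i^{J_i}. -/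
open MvPolynomial

/-- The exponent multi-index of the monomial `x^I y^J z^K` in
`ℝ[x_1,…,x_N,y_1,…,y_N,z_1,…,z_N]`, encoded as a finitely supported function on
`Fin 3 × Fin N` where `(0,i) ↦ x_i`, `(1,i) ↦ y_i`, `(2,i) ↦ z_i`. -/
noncomputable def expIdx {N : ℕ} (I J K : Fin N →₀ ℕ) : (Fin 3 × Fin N) →₀ ℕ :=
  Finsupp.equivFunOnFinite.symm
    (fun p => if p.1 = 0 then I p.2 else if p.1 = 1 then J p.2 else K p.2)

section Substitution

variable {N : ℕ}

theorem Fin.eq_or_eq_or_eq_of_distinct {a b c : Fin 3} (hab : a ≠ b) (hac : a ≠ c)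
    (hbc : b ≠ c) (j : Fin 3) : j = a ∨ j = b ∨ j = c := by
  lia

theorem Fin.prod_univ_three_of_distinct {M : Type*} [CommMonoid M] {a b c : Fin 3}
    (hab : a ≠ b) (hac : a ≠ c) (hbc : b ≠ c) (g : Fin 3 → M) :
    ∏ j, g j = g a * g b * g c := by
  have h : (Finset.univ : Finset (Fin 3)) = {a, b, c} := by
    revert a b c
    decide
  rw [h, Finset.prod_insert (by simp [hab, hac]), Finset.prod_insert (by simp [hbc]),
    Finset.prod_singleton, mul_assoc]

/-- The images of the variables under the substitution that keeps block `a`, and expresses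
block `b` as `ε` times the remaining block. -/
noncomputable def blockSubst (ε : Fin N → ℝ) (a b : Fin 3) (p : Fin 3 × Fin N) :
    MvPolynomial (Fin N ⊕ Fin N) ℝ :=
  if p.1 = a then X (Sum.inl p.2)
  else if p.1 = b then C (ε p.2) * X (Sum.inr p.2)
  else X (Sum.inr p.2)

variable {a b c : Fin 3}

theorem aeval_blockSubst_monomial (ε : Fin N → ℝ) (hab : a ≠ b) (hac : a ≠ c) (hbc : b ≠ c)
    (m : Fin 3 × Fin N →₀ ℕ) (I J K : Fin N →₀ ℕ) (r : ℝ)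
    (ha : ∀ i, m (a, i) = I i) (hb : ∀ i, m (b, i) = J i) (hc : ∀ i, m (c, i) = K i) :
    aeval (blockSubst ε a b) (monomial m r) =
      monomial (Finsupp.sumElim I (J + K)) ((∏ i, ε i ^ J i) * r) := by
  rw [aeval_monomial, monomial_eq, Finsupp.prod_fintype _ _ (by simp),
    Finsupp.prod_fintype _ _ (by simp), Fintype.prod_sum_type, Fintype.prod_prod_type,
    Fin.prod_univ_three_of_distinct hab hac hbc]
  simp only [blockSubst, ha, hb, hc, hab.symm, hac.symm, hbc.symm, if_true, if_false, mul_pow,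
    Finset.prod_mul_distrib, algebraMap_eq, Finsupp.sumElim_inl, Finsupp.sumElim_inr,
    Finsupp.add_apply, pow_add, map_mul, map_prod, map_pow]
  ring

theorem coeff_aeval_blockSubst (ε : Fin N → ℝ) (hab : a ≠ b) (hac : a ≠ c) (hbc : b ≠ c)
    (D : (Fin N →₀ ℕ) → (Fin N →₀ ℕ) → (Fin N →₀ ℕ) → (Fin 3 × Fin N →₀ ℕ))
    (ha : ∀ I J K i, D I J K (a, i) = I i) (hb : ∀ I J K i, D I J K (b, i) = J i)
    (hc : ∀ I J K i, D I J K (c, i) = K i) (P : MvPolynomial (Fin 3 × Fin N) ℝ)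
    (I T : Fin N →₀ ℕ) :
    coeff (Finsupp.sumElim I T) (aeval (blockSubst ε a b) P) =
      ∑ J ∈ Finset.Iic T, (∏ i, ε i ^ J i) * coeff (D I J (T - J)) P := by
  induction P using MvPolynomial.induction_on' with
  | add p q hp hq =>
    simp only [map_add, coeff_add, hp, hq, mul_add, Finset.sum_add_distrib]
  | monomial m r =>
    let I₀ : Fin N →₀ ℕ := Finsupp.equivFunOnFinite.symm fun i => m (a, i)
    let J₀ : Fin N →₀ ℕ := Finsupp.equivFunOnFinite.symm fun i => m (b, i)
    let K₀ : Fin N →₀ ℕ := Finsupp.equivFunOnFinite.symm fun i => m (c, i)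
    have key : ∀ J ∈ Finset.Iic T, m = D I J (T - J) ↔
        (J₀ = J ∧ Finsupp.sumElim I₀ (J₀ + K₀) = Finsupp.sumElim I T) := by
      intro J hJ
      have hJ' : ∀ i, J i ≤ T i := Finset.mem_Iic.mp hJ
      constructor
      · intro h
        refine ⟨Finsupp.ext fun i => ?_, Finsupp.ext ?_⟩
        · simp [J₀, h, hb]
        · rintro (i | i)
          · simp [I₀, h, ha]
          · simp [J₀, K₀, h, hb, hc, hJ' i]
      · rintro ⟨rfl, h⟩
        ext ⟨j, i⟩
        have h₁ := DFunLike.congr_fun h (Sum.inl i)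
        have h₂ := DFunLike.congr_fun h (Sum.inr i)
        simp only [Finsupp.sumElim_inl, Finsupp.sumElim_inr, Finsupp.add_apply] at h₁ h₂
        obtain rfl | rfl | rfl := Fin.eq_or_eq_or_eq_of_distinct hab hac hbc j
        · rw [ha, ← h₁]; rfl
        · rw [hb]; rfl
        · rw [hc, Finsupp.tsub_apply, ← h₂, Nat.add_sub_cancel_left]; rfl
    rw [aeval_blockSubst_monomial ε hab hac hbc m I₀ J₀ K₀ r (fun _ => rfl) (fun _ => rfl)
      (fun _ => rfl), coeff_monomial]
    have hsum : ∀ J ∈ Finset.Iic T,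
        (∏ i, ε i ^ J i) * coeff (D I J (T - J)) (monomial m r) =
        if J₀ = J then (if Finsupp.sumElim I₀ (J₀ + K₀) = Finsupp.sumElim I T then
          (∏ i, ε i ^ J i) * r else 0) else 0 := by
      intro J hJ
      simp only [coeff_monomial, key J hJ, ite_and, mul_ite, mul_zero]
    rw [Finset.sum_congr rfl hsum, Finset.sum_ite_eq]
    split_ifs with h hT hT
    · rfl
    · refine absurd (Finset.mem_Iic.mpr fun i => ?_) hT
      have h₂ := DFunLike.congr_fun h (Sum.inr i)
      simp only [Finsupp.sumElim_inr, Finsupp.add_apply] at h₂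
      omega
    · rfl
    · rfl

theorem eval_aeval_blockSubst (ε : Fin N → ℝ) (hab : a ≠ b) (hac : a ≠ c) (hbc : b ≠ c)
    (P : MvPolynomial (Fin 3 × Fin N) ℝ) (v : Fin 3 × Fin N → ℝ) (w : Fin N ⊕ Fin N → ℝ)
    (ha : ∀ i, v (a, i) = w (Sum.inl i)) (hb : ∀ i, v (b, i) = ε i * w (Sum.inr i))
    (hc : ∀ i, v (c, i) = w (Sum.inr i)) :
    eval w (aeval (blockSubst ε a b) P) = eval v P := by
  have hv : v = fun p => eval w (blockSubst ε a b p) := by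
    ext ⟨j, i⟩
    obtain rfl | rfl | rfl := Fin.eq_or_eq_or_eq_of_distinct hab hac hbc j
    · simp [blockSubst, ha]
    · simp [blockSubst, hb, hab.symm]
    · simp [blockSubst, hc, hac.symm, hbc.symm]
  subst hv
  induction P using MvPolynomial.induction_on with
  | C r => simp
  | add p q hp hq => simp only [map_add, hp, hq]
  | mul_X p n hp => simp only [map_mul, hp, aeval_X, eval_X]

/-- A polynomial vanishes on the subspace where block `b` is `ε` times block `c` if and only if
the corresponding family of linear equations in its coefficients holds. -/
theorem eval_eq_zero_on_block_iff (ε : Fin N → ℝ) (hab : a ≠ b) (hac : a ≠ c) (hbc : b ≠ c)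
    (D : (Fin N →₀ ℕ) → (Fin N →₀ ℕ) → (Fin N →₀ ℕ) → (Fin 3 × Fin N →₀ ℕ))
    (ha : ∀ I J K i, D I J K (a, i) = I i) (hb : ∀ I J K i, D I J K (b, i) = J i)
    (hc : ∀ I J K i, D I J K (c, i) = K i) (P : MvPolynomial (Fin 3 × Fin N) ℝ) :
    (∀ v : Fin 3 × Fin N → ℝ, (∀ i, v (b, i) = ε i * v (c, i)) → eval v P = 0) ↔
      ∀ I T : Fin N →₀ ℕ,
        ∑ J ∈ Finset.Iic T, (∏ i, ε i ^ J i) * coeff (D I J (T - J)) P = 0 := by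
  have h_zero : (∀ v : Fin 3 × Fin N → ℝ, (∀ i, v (b, i) = ε i * v (c, i)) → eval v P = 0) ↔
      aeval (blockSubst ε a b) P = 0 := by
    constructor
    · refine fun h => MvPolynomial.funext fun w => ?_
      rw [map_zero, eval_aeval_blockSubst ε hab hac hbc P
        (fun p => if p.1 = a then w (Sum.inl p.2) else
          if p.1 = b then ε p.2 * w (Sum.inr p.2) else w (Sum.inr p.2)) w
        (by simp) (by simp [hab.symm]) (by simp [hac.symm, hbc.symm])]
      exact h _ (by simp [hab.symm, hac.symm, hbc.symm])
    · intro h v hv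
      rw [← eval_aeval_blockSubst ε hab hac hbc P v
        (Sum.elim (fun i => v (a, i)) fun i => v (c, i)) (fun _ => rfl) hv (fun _ => rfl),
        h, map_zero]
  rw [h_zero]
  simp only [← coeff_aeval_blockSubst ε hab hac hbc D ha hb hc]
  refine ⟨fun h I T => by rw [h, coeff_zero], fun h => MvPolynomial.ext _ _ fun s => ?_⟩
  have hs : s = Finsupp.sumElim (Finsupp.equivFunOnFinite.symm fun i => s (Sum.inl i))
      (Finsupp.equivFunOnFinite.symm fun i => s (Sum.inr i)) := by
    ext (i | i) <;> simp
  rw [hs, h, coeff_zero]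

end Substitution

/-- A polynomial `P ∈ ℝ[x_1,…,x_N,y_1,…,y_N,z_1,…,z_N]`, with
`a_{I,J,K}` the coefficient of `x^I y^J z^K`, vanishes at every point of
`V_ε = {y = diag(ε) z} ∪ {z = diag(ε) x} ∪ {x = diag(ε) y}` if and only if for
all multi-indices `I, T ∈ ℕ^N` the three families of linear equations hold:
`Σ_{J ≤ T} ε^J a_{I,J,T-J} = 0`, `Σ_{J ≤ T} ε^J a_{J,T-J,I} = 0`, and
`Σ_{J ≤ T} ε^J a_{T-J,I,J} = 0`, where `ε^J = ∏ i, ε_i^{J_i}`. -/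
theorem stmt_0 (N : ℕ) (hN : 0 < N) (ε : Fin N → ℝ) (hε : ∀ i, ε i = 1 ∨ ε i = -1)
    (P : MvPolynomial (Fin 3 × Fin N) ℝ) :
    (∀ v : Fin 3 × Fin N → ℝ,
        ((∀ i : Fin N, v (1, i) = ε i * v (2, i)) ∨
         (∀ i : Fin N, v (2, i) = ε i * v (0, i)) ∨
         (∀ i : Fin N, v (0, i) = ε i * v (1, i))) →
        eval v P = 0) ↔
      (∀ I T : Fin N →₀ ℕ,
        (∑ J ∈ Finset.Iic T, (∏ i : Fin N, ε i ^ J i) * coeff (expIdx I J (T - J)) P = 0) ∧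
        (∑ J ∈ Finset.Iic T, (∏ i : Fin N, ε i ^ J i) * coeff (expIdx J (T - J) I) P = 0) ∧
        (∑ J ∈ Finset.Iic T, (∏ i : Fin N, ε i ^ J i) * coeff (expIdx (T - J) I J) P = 0)) := by
  have h₁ := eval_eq_zero_on_block_iff (a := 0) (b := 1) (c := 2) ε (by decide) (by decide)
    (by decide) (fun I J K => expIdx I J K) (by simp [expIdx]) (by simp [expIdx])
    (by simp [expIdx]) P
  have h₂ := eval_eq_zero_on_block_iff (a := 2) (b := 0) (c := 1) ε (by decide) (by decide)
    (by decide) (fun I J K => expIdx J K I) (by simp [expIdx]) (by simp [expIdx])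
    (by simp [expIdx]) P
  have h₃ := eval_eq_zero_on_block_iff (a := 1) (b := 2) (c := 0) ε (by decide) (by decide)
    (by decide) (fun I J K => expIdx K I J) (by simp [expIdx]) (by simp [expIdx])
    (by simp [expIdx]) P
  simp only [forall_and, or_imp, ← h₁, ← h₂, ← h₃]
  tauto
end

section
/- The vanishing ideal of V_ε equals the intersection of the three linear ideals: {P ∈ R : P(p) = 0 for every p ∈ V_ε} = I_ε^x ∩ I_ε^y ∩ I_ε^z. -/
open MvPolynomial

/-- A polynomial is congruent to its image under a substitution of the variables, modulo any
ideal containing the differences between the variables and their substitutes. -/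
theorem MvPolynomial.sub_aeval_mem_ideal {σ R : Type*} [CommRing R]
    {I : Ideal (MvPolynomial σ R)} {f : σ → MvPolynomial σ R} (h : ∀ s, X s - f s ∈ I)
    (P : MvPolynomial σ R) : P - aeval f P ∈ I := by
  have key : Ideal.Quotient.mkₐ R I = (Ideal.Quotient.mkₐ R I).comp (aeval f) := by
    ext s
    simpa using Ideal.Quotient.eq.mpr (h s)
  exact Ideal.Quotient.eq.mp (by simpa using DFunLike.congr_fun key P)

/-- Over an infinite domain, the ideal generated by the linear forms
`X (a, i) - C (c i) * X (b, i)` with `a ≠ b` is the vanishing ideal of their common zeros. -/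
theorem MvPolynomial.mem_span_X_sub_C_mul_X_iff {κ ι R : Type*} [CommRing R] [IsDomain R]
    [Infinite R] {a b : κ} (hab : a ≠ b) (c : ι → R) (P : MvPolynomial (κ × ι) R) :
    P ∈ Ideal.span {q : MvPolynomial (κ × ι) R | ∃ i, q = X (a, i) - C (c i) * X (b, i)} ↔
      ∀ v : κ × ι → R, (∀ i, v (a, i) = c i * v (b, i)) → eval v P = 0 := by
  classical
  constructor
  · intro hP v hv
    suffices h : Ideal.span {q : MvPolynomial (κ × ι) R |
        ∃ i, q = X (a, i) - C (c i) * X (b, i)} ≤ RingHom.ker (eval v) from h hP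
    rw [Ideal.span_le]
    rintro _ ⟨i, rfl⟩
    simp [RingHom.mem_ker, hv i]
  · intro hP
    let f : κ × ι → MvPolynomial (κ × ι) R := fun s ↦
      if s.1 = a then C (c s.2) * X (b, s.2) else X s
    have hf : aeval f P = 0 := by
      refine MvPolynomial.funext fun v ↦ ?_
      rw [map_zero, ← hP (fun s ↦ eval v (f s)) (by simp [f, hab.symm]), aeval_def,
        ← coe_eval₂Hom, ← RingHom.comp_apply]
      congr 1
      ext s <;> simp
    have hmem := sub_aeval_mem_ideal (f := f) (I := Ideal.span {q : MvPolynomial (κ × ι) R |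
        ∃ i, q = X (a, i) - C (c i) * X (b, i)}) ?_ P
    · rwa [hf, sub_zero] at hmem
    · rintro ⟨k, i⟩
      by_cases hk : k = a
      · subst hk
        exact Ideal.subset_span ⟨i, by simp [f]⟩
      · simp [f, hk]

/-- The vanishing ideal of
`V_ε = {y = diag(ε) z} ∪ {z = diag(ε) x} ∪ {x = diag(ε) y}` equals the
intersection `I_ε^x ∩ I_ε^y ∩ I_ε^z` of the three linear ideals. Variables are
encoded by `Fin 3 × Fin N`, `(0,i) ↦ x_i`, `(1,i) ↦ y_i`, `(2,i) ↦ z_i`. -/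
theorem stmt_2 (N : ℕ) (hN : 0 < N) (ε : Fin N → ℝ) (hε : ∀ i, ε i = 1 ∨ ε i = -1) :
    {P : MvPolynomial (Fin 3 × Fin N) ℝ |
        ∀ v : Fin 3 × Fin N → ℝ,
          ((∀ i : Fin N, v (1, i) = ε i * v (2, i)) ∨
           (∀ i : Fin N, v (2, i) = ε i * v (0, i)) ∨
           (∀ i : Fin N, v (0, i) = ε i * v (1, i))) →
          eval v P = 0} =
      ↑(Ideal.span {q : MvPolynomial (Fin 3 × Fin N) ℝ |
            ∃ i : Fin N, q = X (1, i) - C (ε i) * X (2, i)} ⊓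
        Ideal.span {q : MvPolynomial (Fin 3 × Fin N) ℝ |
            ∃ i : Fin N, q = X (2, i) - C (ε i) * X (0, i)} ⊓
        Ideal.span {q : MvPolynomial (Fin 3 × Fin N) ℝ |
            ∃ i : Fin N, q = X (0, i) - C (ε i) * X (1, i)}) := by
  ext P
  simp only [Set.mem_ofPred_eq, SetLike.mem_coe, Submodule.mem_inf,
    mem_span_X_sub_C_mul_X_iff (show (1 : Fin 3) ≠ 2 by decide),
    mem_span_X_sub_C_mul_X_iff (show (2 : Fin 3) ≠ 0 by decide),
    mem_span_X_sub_C_mul_X_iff (show (0 : Fin 3) ≠ 1 by decide),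
    or_imp, forall_and, and_assoc]
end

section
/- Each pairwise product of the three linear ideals equals the corresponding intersection: I_ε^x · I_ε^z = I_ε^x ∩ I_ε^z, I_ε^x · I_ε^y = I_ε^x ∩ I_ε^y, and I_ε^y · I_ε^z = I_ε^y ∩ I_ε^z. -/
open MvPolynomial

/-- If a ring endomorphism `σ` kills `J`, is the identity modulo `J`, and fixes every generator of
`I = Ideal.span A`, then `I * J = I ⊓ J`. -/
theorem Ideal.span_mul_eq_inf_of_endomorphism {R : Type*} [CommRing R] {A : Set R} {J : Ideal R}
    (σ : R →+* R) (hJ : ∀ r ∈ J, σ r = 0) (hσ : ∀ r, r - σ r ∈ J) (hA : ∀ a ∈ A, σ a = a) :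
    Ideal.span A * J = Ideal.span A ⊓ J := by
  refine le_antisymm Ideal.mul_le_inf fun r hr => ?_
  have key : ∀ r ∈ Ideal.span A, r - σ r ∈ Ideal.span A * J := by
    intro r hr
    induction hr using Submodule.span_induction with
    | mem a ha => simp [hA a ha]
    | zero => simp
    | add x y _ _ hx hy =>
      rw [map_add, add_sub_add_comm]
      exact add_mem hx hy
    | smul c x hx ih =>
      have : c • x - σ (c • x) = x * (c - σ c) + σ c * (x - σ x) := by
        simp only [smul_eq_mul, map_mul]
        ring
      rw [this]
      exact add_mem (Ideal.mul_mem_mul hx (hσ c)) (Ideal.mul_mem_left _ _ ih)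
  simpa [hJ r hr.2] using key r hr.1

/-- A substitution `f` of the variables that vanishes on `B`, is the identity modulo
`Ideal.span B`, and fixes `A` shows that the product of the ideals spanned by `A` and `B` is their
intersection. -/
theorem MvPolynomial.span_mul_span_eq_inf_of_aeval {S τ : Type*} [CommRing S]
    {A B : Set (MvPolynomial τ S)} (f : τ → MvPolynomial τ S)
    (hB : ∀ b ∈ B, aeval f b = 0) (hf : ∀ v, X v - f v ∈ Ideal.span B)
    (hA : ∀ a ∈ A, aeval f a = a) :
    Ideal.span A * Ideal.span B = Ideal.span A ⊓ Ideal.span B := by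
  refine Ideal.span_mul_eq_inf_of_endomorphism (aeval f).toRingHom (fun r hr => ?_) (fun r => ?_) hA
  · have : Ideal.span B ≤ RingHom.ker (aeval f).toRingHom := Ideal.span_le.2 hB
    exact this hr
  · have : Ideal.Quotient.mkₐ S (Ideal.span B) =
        (Ideal.Quotient.mkₐ S (Ideal.span B)).comp (aeval f) := by
      ext v
      simpa using Ideal.Quotient.eq.2 (hf v)
    exact Ideal.Quotient.eq.1 (DFunLike.congr_fun this r)

/-- Each pairwise product of the three linear ideals
`I_ε^x = ⟨y_i - ε_i z_i⟩`, `I_ε^y = ⟨z_i - ε_i x_i⟩`, `I_ε^z = ⟨x_i - ε_i y_i⟩`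
in `ℝ[x_1,…,x_N,y_1,…,y_N,z_1,…,z_N]` equals the corresponding intersection.
Variables are encoded by `Fin 3 × Fin N`, `(0,i) ↦ x_i`, `(1,i) ↦ y_i`,
`(2,i) ↦ z_i`. -/
theorem stmt_5 (N : ℕ) (hN : 0 < N) (ε : Fin N → ℝ) (hε : ∀ i, ε i = 1 ∨ ε i = -1)
    (Ix Iy Iz : Ideal (MvPolynomial (Fin 3 × Fin N) ℝ))
    (hIx : Ix = Ideal.span {q : MvPolynomial (Fin 3 × Fin N) ℝ |
        ∃ i : Fin N, q = X (1, i) - C (ε i) * X (2, i)})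
    (hIy : Iy = Ideal.span {q : MvPolynomial (Fin 3 × Fin N) ℝ |
        ∃ i : Fin N, q = X (2, i) - C (ε i) * X (0, i)})
    (hIz : Iz = Ideal.span {q : MvPolynomial (Fin 3 × Fin N) ℝ |
        ∃ i : Fin N, q = X (0, i) - C (ε i) * X (1, i)}) :
    Ix * Iz = Ix ⊓ Iz ∧ Ix * Iy = Ix ⊓ Iy ∧ Iy * Iz = Iy ⊓ Iz := by
  have hC : ∀ i, (C (ε i) * C (ε i) : MvPolynomial (Fin 3 × Fin N) ℝ) = 1 := by
    intro i
    rw [← C_mul, ← C_1]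
    rcases hε i with h | h <;> simp [h]
  subst hIx hIy hIz
  refine ⟨?_, ?_, ?_⟩
  · refine MvPolynomial.span_mul_span_eq_inf_of_aeval
      (fun v => if v.1 = 0 then C (ε v.2) * X (1, v.2) else X v) ?_ ?_ ?_
    · rintro _ ⟨i, rfl⟩
      simp [← algebraMap_eq]
    · rintro ⟨k, i⟩
      by_cases hk : k = 0
      · subst hk
        exact Ideal.subset_span ⟨i, by simp⟩
      · simp [hk]
    · rintro _ ⟨i, rfl⟩
      simp [← algebraMap_eq]
  · refine MvPolynomial.span_mul_span_eq_inf_of_aeval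
      (fun v => if v.1 = 0 then C (ε v.2) * X (2, v.2) else X v) ?_ ?_ ?_
    · rintro _ ⟨i, rfl⟩
      simp [algebraMap_eq, ← mul_assoc, hC]
    · rintro ⟨k, i⟩
      by_cases hk : k = 0
      · subst hk
        have : (X (0, i) - C (ε i) * X (2, i) : MvPolynomial (Fin 3 × Fin N) ℝ) =
            -C (ε i) * (X (2, i) - C (ε i) * X (0, i)) := by
          linear_combination (-X (0, i)) * hC i
        simp only [if_true, this]
        exact Ideal.mul_mem_left _ _ (Ideal.subset_span ⟨i, rfl⟩)
      · simp [hk]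
    · rintro _ ⟨i, rfl⟩
      simp [← algebraMap_eq]
  · rw [mul_comm, inf_comm]
    refine MvPolynomial.span_mul_span_eq_inf_of_aeval
      (fun v => if v.1 = 2 then C (ε v.2) * X (0, v.2) else X v) ?_ ?_ ?_
    · rintro _ ⟨i, rfl⟩
      simp [← algebraMap_eq]
    · rintro ⟨k, i⟩
      by_cases hk : k = 2
      · subst hk
        exact Ideal.subset_span ⟨i, by simp⟩
      · simp [hk]
    · rintro _ ⟨i, rfl⟩
      simp [← algebraMap_eq]
end

section
/- For every i, j, k ∈ {1,…,N}, the polynomial T_ε^{ijk} = (x_i − ε_i y_i)(y_j − ε_j z_j)(z_k − ε_k x_k) belongs to I_ε^x ∩ I_ε^y ∩ I_ε^z; and for every pair i, j with ε_i = ε_j = 1, the polynomial P^{ij} = (z_i − x_i)(x_j − y_j) − (z_j − x_j)(x_i − y_i) belongs to I_ε^x ∩ I_ε^y ∩ I_ε^z. -/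
open MvPolynomial

/-- For all `i, j, k` the polynomial
`T_ε^{ijk} = (x_i - ε_i y_i)(y_j - ε_j z_j)(z_k - ε_k x_k)` lies in
`I_ε^x ∩ I_ε^y ∩ I_ε^z`, and for all `i, j` with `ε_i = ε_j = 1` the polynomial
`P^{ij} = (z_i - x_i)(x_j - y_j) - (z_j - x_j)(x_i - y_i)` lies in
`I_ε^x ∩ I_ε^y ∩ I_ε^z`. Variables are encoded by `Fin 3 × Fin N`,
`(0,i) ↦ x_i`, `(1,i) ↦ y_i`, `(2,i) ↦ z_i`. -/
theorem stmt_6 (N : ℕ) (hN : 0 < N) (ε : Fin N → ℝ) (hε : ∀ i, ε i = 1 ∨ ε i = -1)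
    (Ix Iy Iz : Ideal (MvPolynomial (Fin 3 × Fin N) ℝ))
    (hIx : Ix = Ideal.span {q : MvPolynomial (Fin 3 × Fin N) ℝ |
        ∃ i : Fin N, q = X (1, i) - C (ε i) * X (2, i)})
    (hIy : Iy = Ideal.span {q : MvPolynomial (Fin 3 × Fin N) ℝ |
        ∃ i : Fin N, q = X (2, i) - C (ε i) * X (0, i)})
    (hIz : Iz = Ideal.span {q : MvPolynomial (Fin 3 × Fin N) ℝ |
        ∃ i : Fin N, q = X (0, i) - C (ε i) * X (1, i)}) :
    (∀ i j k : Fin N,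
        (X (0, i) - C (ε i) * X (1, i)) * (X (1, j) - C (ε j) * X (2, j)) *
          (X (2, k) - C (ε k) * X (0, k)) ∈ Ix ⊓ Iy ⊓ Iz) ∧
    (∀ i j : Fin N, ε i = 1 → ε j = 1 →
        (X (2, i) - X (0, i)) * (X (0, j) - X (1, j)) -
          (X (2, j) - X (0, j)) * (X (0, i) - X (1, i)) ∈ Ix ⊓ Iy ⊓ Iz) := by
  subst hIx hIy hIz
  refine ⟨fun i j k => ⟨⟨?_, ?_⟩, ?_⟩, fun i j hi hj => ?_⟩
  · exact Ideal.mul_mem_right _ _ (Ideal.mul_mem_left _ _ (Ideal.subset_span ⟨j, rfl⟩))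
  · exact Ideal.mul_mem_left _ _ (Ideal.subset_span ⟨k, rfl⟩)
  · exact Ideal.mul_mem_right _ _ (Ideal.mul_mem_right _ _ (Ideal.subset_span ⟨i, rfl⟩))
  · have mem_span_of_eq_one (a b : Fin 3) (l : Fin N) (hl : ε l = 1) :
        (X (a, l) - X (b, l) : MvPolynomial (Fin 3 × Fin N) ℝ) ∈
          Ideal.span {q | ∃ m : Fin N, q = X (a, m) - C (ε m) * X (b, m)} :=
      Ideal.subset_span ⟨l, by rw [hl, C_1, one_mul]⟩
    refine ⟨⟨?_, ?_⟩, ?_⟩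
    · rw [SetLike.mem_coe]
      convert sub_mem
        (Ideal.mul_mem_right (X (0, i) - X (1, i)) _ (mem_span_of_eq_one 1 2 j hj))
        (Ideal.mul_mem_right (X (0, j) - X (1, j)) _ (mem_span_of_eq_one 1 2 i hi)) using 1
      ring
    · exact sub_mem (Ideal.mul_mem_right _ _ (mem_span_of_eq_one 2 0 i hi))
        (Ideal.mul_mem_right _ _ (mem_span_of_eq_one 2 0 j hj))
    · exact sub_mem (Ideal.mul_mem_left _ _ (mem_span_of_eq_one 0 1 j hj))
        (Ideal.mul_mem_left _ _ (mem_span_of_eq_one 0 1 i hi))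
end

section
/- The ideal of R generated by the set {T_ε^{ijk} : 1 ≤ i,j,k ≤ N} ∪ {P^{ij} : 1 ≤ i,j ≤ N with ε_i = ε_j = 1} equals the intersection I_ε^x ∩ I_ε^y ∩ I_ε^z. -/
open MvPolynomial

/-- A ring endomorphism congruent to the identity modulo `V` and fixing generators of `I`
moves elements of `I` only within `I * V`. -/
theorem Ideal.sub_map_mem_span_mul {R : Type*} [CommRing R] (φ : R →+* R) {V : Ideal R}
    (hφ : ∀ f, f - φ f ∈ V) {S : Set R} (hS : ∀ s ∈ S, φ s = s) {f : R}
    (hf : f ∈ Ideal.span S) : f - φ f ∈ Ideal.span S * V := by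
  induction hf using Submodule.span_induction with
  | mem x hx => simp [hS x hx]
  | zero => simp
  | add x y _ _ hx hy =>
    rw [map_add, add_sub_add_comm]
    exact add_mem hx hy
  | smul r x hx hx' =>
    have h : r • x - φ (r • x) = φ r * (x - φ x) + x * (r - φ r) := by
      simp only [smul_eq_mul, map_mul]
      ring
    rw [h]
    exact add_mem (Ideal.mul_mem_left _ _ hx') (Ideal.mul_mem_mul hx (hφ r))

/-- An algebra endomorphism congruent to the identity modulo `V` on the variables is congruent
to the identity modulo `V` everywhere. -/
theorem MvPolynomial.sub_algHom_mem {σ R : Type*} [CommRing R]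
    (φ : MvPolynomial σ R →ₐ[R] MvPolynomial σ R) {V : Ideal (MvPolynomial σ R)}
    (h : ∀ i, X i - φ (X i) ∈ V) (f : MvPolynomial σ R) : f - φ f ∈ V := by
  have key : (Ideal.Quotient.mkₐ R V) = (Ideal.Quotient.mkₐ R V).comp φ := by
    ext i
    exact Ideal.Quotient.eq.mpr (h i)
  exact Ideal.Quotient.eq.mp (DFunLike.congr_fun key f)

/-- If `v` is a regular family in every order, a syzygy of `v` applied to another family `b`
lands in the ideal of `2 × 2` minors of the matrix with rows `v` and `b`. -/
theorem Ideal.sum_mul_mem_of_syzygy {ι R : Type*} [DecidableEq ι] [CommRing R] (v b : ι → R)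
    (Q : Ideal R) (s : Finset ι) (hQ : ∀ i ∈ s, ∀ j ∈ s, v i * b j - v j * b i ∈ Q)
    (hreg : ∀ (t : Finset ι) (p : ι), p ∉ t → ∀ h, v p * h ∈ Ideal.span (v '' t) →
      h ∈ Ideal.span (v '' t)) (H : ι → R) (hH : ∑ j ∈ s, v j * H j = 0) :
    ∑ j ∈ s, b j * H j ∈ Q := by
  induction s using Finset.induction_on generalizing H with
  | empty => simp
  | insert p s hp ih =>
    rw [Finset.sum_insert hp] at hH
    have hmem : H p ∈ Ideal.span (v '' s) := by
      refine hreg s p hp _ ?_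
      rw [eq_neg_of_add_eq_zero_left hH]
      exact neg_mem (Submodule.sum_mem _ fun j hj => Ideal.mul_mem_right _ _
        (Ideal.subset_span ⟨j, hj, rfl⟩))
    obtain ⟨K, hK⟩ : ∃ K : ι → R, ∑ j ∈ s, K j * v j = H p := by
      obtain ⟨K, hK⟩ := (Submodule.mem_span_image_finset_iff_exists_fun R).mp hmem
      refine ⟨fun j => if h : j ∈ s then K ⟨j, h⟩ else 0, ?_⟩
      rw [← hK, ← Finset.sum_coe_sort]
      exact Finset.sum_congr rfl fun j _ => by simp
    have hsyz : ∑ j ∈ s, v j * (H j + v p * K j) = 0 := by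
      rw [← hH, ← hK, Finset.mul_sum, ← Finset.sum_add_distrib]
      exact Finset.sum_congr rfl fun j _ => by ring
    have h := ih (fun i hi j hj => hQ i (Finset.mem_insert_of_mem hi) j
      (Finset.mem_insert_of_mem hj)) _ hsyz
    have hsplit : ∑ j ∈ insert p s, b j * H j = ∑ j ∈ s, b j * (H j + v p * K j) +
        ∑ j ∈ s, K j * (v j * b p - v p * b j) := by
      rw [Finset.sum_insert hp, ← hK, Finset.mul_sum, ← Finset.sum_add_distrib,
        ← Finset.sum_add_distrib]
      exact Finset.sum_congr rfl fun j _ => by ring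
    rw [hsplit]
    exact add_mem h (Submodule.sum_mem _ fun j hj => Ideal.mul_mem_left _ _
      (hQ j (Finset.mem_insert_of_mem hj) p (Finset.mem_insert_self _ _)))

/-- The linear form `X (l + 1, i) - ε i * X (l + 2, i)`. -/
noncomputable def signedForm {N : ℕ} (ε : Fin N → ℝ) (l : Fin 3) (i : Fin N) :
    MvPolynomial (Fin 3 × Fin N) ℝ :=
  X (l + 1, i) - C (ε i) * X (l + 2, i)

/-- The ideal generated by the linear forms `signedForm ε l i`. -/
noncomputable def signedIdeal {N : ℕ} (ε : Fin N → ℝ) (l : Fin 3) :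
    Ideal (MvPolynomial (Fin 3 × Fin N) ℝ) :=
  Ideal.span (Set.range (signedForm ε l))

theorem signedForm_mem {N : ℕ} (ε : Fin N → ℝ) (l : Fin 3) (i : Fin N) :
    signedForm ε l i ∈ signedIdeal ε l :=
  Ideal.subset_span ⟨i, rfl⟩

theorem C_mul_C_of_sign {σ : Type*} {e : ℝ} (he : e = 1 ∨ e = -1) :
    (C e * C e : MvPolynomial σ ℝ) = 1 := by
  rcases he with rfl | rfl <;> simp

theorem signedIdeal_inf_le_mul {N : ℕ} {ε : Fin N → ℝ} (hε : ∀ i, ε i = 1 ∨ ε i = -1)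
    (l : Fin 3) {f : MvPolynomial (Fin 3 × Fin N) ℝ} (h₁ : f ∈ signedIdeal ε (l + 1))
    (h₂ : f ∈ signedIdeal ε (l + 2)) : f ∈ signedIdeal ε (l + 1) * signedIdeal ε (l + 2) := by
  -- This substitution kills the forms of type `l + 2` and fixes those of type `l + 1`.
  let φ : MvPolynomial (Fin 3 × Fin N) ℝ →ₐ[ℝ] MvPolynomial (Fin 3 × Fin N) ℝ :=
    aeval fun q => if q.1 = l + 1 then C (ε q.2) * X (l, q.2) else X q
  have hφ : ∀ f, f - φ f ∈ signedIdeal ε (l + 2) := by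
    refine sub_algHom_mem φ fun ⟨m, i⟩ => ?_
    by_cases hm : m = l + 1
    · subst hm
      have h : X (l + 1, i) - φ (X (l + 1, i)) = -C (ε i) * signedForm ε (l + 2) i := by
        have e₁ : l + 2 + 1 = l := by fin_cases l <;> rfl
        have e₂ : l + 2 + 2 = l + 1 := by fin_cases l <;> rfl
        simp only [φ, aeval_X, if_true, signedForm, e₁, e₂]
        linear_combination -X (l + 1, i) * C_mul_C_of_sign (hε i)
      rw [h]
      exact Ideal.mul_mem_left _ _ (signedForm_mem ε _ i)
    · simp [φ, hm]
  have hfix : ∀ s ∈ Set.range (signedForm ε (l + 1)), φ s = s := by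
    rintro _ ⟨i, rfl⟩
    fin_cases l <;> simp [φ, signedForm]
  have hzero : φ f = 0 := by
    have hle : signedIdeal ε (l + 2) ≤ RingHom.ker φ := by
      refine Ideal.span_le.mpr ?_
      rintro _ ⟨i, rfl⟩
      have e₁ : l + 2 + 1 = l := by fin_cases l <;> rfl
      have e₂ : l + 2 + 2 = l + 1 := by fin_cases l <;> rfl
      have e₃ : l ≠ l + 1 := by fin_cases l <;> decide
      simp only [SetLike.mem_coe, RingHom.mem_ker, φ, signedForm, e₁, e₂, map_sub, map_mul, aeval_X,
        e₃, if_true, if_false, algHom_C, algebraMap_eq]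
      linear_combination -X (l, i) * C_mul_C_of_sign (hε i)
    exact hle h₂
  have h := Ideal.sub_map_mem_span_mul φ.toRingHom hφ hfix h₁
  rwa [show φ.toRingHom f = 0 from hzero, sub_zero] at h

/-- The substitution killing the forms of type `l` at the indices with `ε i = -1` and fixing all
other forms. -/
noncomputable def killNeg {N : ℕ} (ε : Fin N → ℝ) (l : Fin 3) :
    MvPolynomial (Fin 3 × Fin N) ℝ →ₐ[ℝ] MvPolynomial (Fin 3 × Fin N) ℝ :=
  aeval fun q => if ε q.2 = 1 then X q else
    X q + C (if q.1 = l then 2⁻¹ else -2⁻¹) * signedForm ε l q.2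

theorem killNeg_signedForm {N : ℕ} {ε : Fin N → ℝ} (hε : ∀ i, ε i = 1 ∨ ε i = -1) (l m : Fin 3)
    (i : Fin N) : killNeg ε l (signedForm ε m i) =
      if ε i = -1 ∧ m = l then 0 else signedForm ε m i := by
  have half : (C 2⁻¹ + C 2⁻¹ : MvPolynomial (Fin 3 × Fin N) ℝ) = 1 := by
    rw [← C_add, ← two_mul, mul_inv_cancel₀ two_ne_zero, C_1]
  rcases hε i with h | h
  · have h' : ¬ ((1 : ℝ) = -1) := by norm_num
    simp [killNeg, signedForm, h, h']
  · have h' : ¬ ((-1 : ℝ) = 1) := by norm_num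
    fin_cases l <;> fin_cases m <;>
    simp only [killNeg, signedForm, h, h', map_sub, map_mul, aeval_X, if_false, C_neg, C_1] <;>
    simp <;> grind

theorem sub_killNeg_mem {N : ℕ} {ε : Fin N → ℝ} (l : Fin 3)
    (f : MvPolynomial (Fin 3 × Fin N) ℝ) : f - killNeg ε l f ∈ signedIdeal ε l := by
  refine sub_algHom_mem _ (fun q => ?_) f
  by_cases h : ε q.2 = 1
  · simp [killNeg, h]
  · simp only [killNeg, aeval_X, h, if_false, sub_add_cancel_left]
    exact neg_mem (Ideal.mul_mem_left _ _ (signedForm_mem ε l _))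

theorem killNeg_mem {N : ℕ} {ε : Fin N → ℝ} (hε : ∀ i, ε i = 1 ∨ ε i = -1) (l m : Fin 3)
    {f : MvPolynomial (Fin 3 × Fin N) ℝ} (hf : f ∈ signedIdeal ε m) :
    killNeg ε l f ∈ signedIdeal ε m := by
  have hle : signedIdeal ε m ≤ (signedIdeal ε m).comap (killNeg ε l) := by
    refine Ideal.span_le.mpr ?_
    rintro _ ⟨i, rfl⟩
    simp only [SetLike.mem_coe, Ideal.mem_comap, killNeg_signedForm hε]
    split_ifs
    · exact zero_mem _
    · exact signedForm_mem ε m i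
  exact hle hf

theorem sub_killNeg_mem_mul {N : ℕ} {ε : Fin N → ℝ} (hε : ∀ i, ε i = 1 ∨ ε i = -1) (l : Fin 3)
    {f : MvPolynomial (Fin 3 × Fin N) ℝ} (hf : ∀ m, f ∈ signedIdeal ε m) :
    f - killNeg ε l f ∈ signedIdeal ε 2 * signedIdeal ε 0 * signedIdeal ε 1 := by
  have hprod : signedIdeal ε 2 * signedIdeal ε 0 * signedIdeal ε 1 =
      signedIdeal ε (l + 1) * signedIdeal ε (l + 2) * signedIdeal ε l := by
    fin_cases l <;> simp <;> ring
  rw [hprod]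
  have h := signedIdeal_inf_le_mul hε l (hf _) (hf _)
  rw [signedIdeal, signedIdeal, Ideal.span_mul_span'] at h ⊢
  refine Ideal.sub_map_mem_span_mul (killNeg ε l).toRingHom (sub_killNeg_mem l) ?_ h
  rintro _ ⟨_, ⟨i, rfl⟩, _, ⟨j, rfl⟩, rfl⟩
  have e₁ : l + 1 ≠ l := by fin_cases l <;> decide
  have e₂ : l + 2 ≠ l := by fin_cases l <;> decide
  simp [killNeg_signedForm hε, e₁, e₂]

/-- The substitution sending the variables at the indices with `ε i = -1` to zero. -/
noncomputable def restrictPos {N : ℕ} (ε : Fin N → ℝ) :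
    MvPolynomial (Fin 3 × Fin N) ℝ →ₐ[ℝ] MvPolynomial (Fin 3 × Fin N) ℝ :=
  aeval fun q => if ε q.2 = 1 then X q else 0

theorem restrictPos_signedForm {N : ℕ} (ε : Fin N → ℝ) (l : Fin 3) (i : Fin N) :
    restrictPos ε (signedForm ε l i) = if ε i = 1 then signedForm ε l i else 0 := by
  by_cases h : ε i = 1 <;> simp [restrictPos, signedForm, h]

theorem killNeg_comp_eq_restrictPos {N : ℕ} {ε : Fin N → ℝ} (hε : ∀ i, ε i = 1 ∨ ε i = -1)
    (f : MvPolynomial (Fin 3 × Fin N) ℝ) :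
    killNeg ε 0 (killNeg ε 1 (killNeg ε 2 f)) = restrictPos ε f := by
  have key : (killNeg ε 0).comp ((killNeg ε 1).comp (killNeg ε 2)) = restrictPos ε := by
    refine algHom_ext fun ⟨m, i⟩ => ?_
    rcases hε i with h | h
    · simp [killNeg, restrictPos, h]
    · have h' : ¬ ((-1 : ℝ) = 1) := by norm_num
      have hX : X (m, i) = C (1 / 2) * (signedForm ε (m + 1) i + signedForm ε (m + 2) i
          - signedForm ε m i) := by
        have e₁ : m + 1 + 1 = m + 2 := by fin_cases m <;> rfl
        have e₂ : m + 1 + 2 = m := by fin_cases m <;> rfl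
        have e₃ : m + 2 + 1 = m := by fin_cases m <;> rfl
        have e₄ : m + 2 + 2 = m + 1 := by fin_cases m <;> rfl
        have half : (C (1 / 2) + C (1 / 2) : MvPolynomial (Fin 3 × Fin N) ℝ) = 1 := by
          rw [← C_add, add_halves, C_1]
        simp only [signedForm, h, C_neg, C_1, e₁, e₂, e₃, e₄]
        linear_combination -X (m, i) * half
      simp only [AlgHom.comp_apply]
      rw [hX]
      simp only [map_mul, map_sub, map_add, restrictPos_signedForm, killNeg_signedForm hε, h]
      fin_cases m <;> simp [killNeg_signedForm hε, h, h']
  exact DFunLike.congr_fun key f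

theorem sub_restrictPos_mem {N : ℕ} {ε : Fin N → ℝ} (hε : ∀ i, ε i = 1 ∨ ε i = -1)
    {f : MvPolynomial (Fin 3 × Fin N) ℝ} (hf : ∀ m, f ∈ signedIdeal ε m) :
    f - restrictPos ε f ∈ signedIdeal ε 2 * signedIdeal ε 0 * signedIdeal ε 1 := by
  have h₂ := sub_killNeg_mem_mul hε 2 hf
  have hf₂ := fun m => killNeg_mem hε 2 m (hf m)
  have h₁ := sub_killNeg_mem_mul hε 1 hf₂
  have hf₁ := fun m => killNeg_mem hε 1 m (hf₂ m)
  have h₀ := sub_killNeg_mem_mul hε 0 hf₁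
  rw [← killNeg_comp_eq_restrictPos hε]
  have h := add_mem (add_mem h₂ h₁) h₀
  rwa [sub_add_sub_cancel, sub_add_sub_cancel] at h

theorem X_sub_X_regular {N : ℕ} (t : Finset (Fin N)) (p : Fin N) (hp : p ∉ t)
    (h : MvPolynomial (Fin 3 × Fin N) ℝ)
    (hh : (X (0, p) - X (1, p)) * h ∈
      Ideal.span ((fun i => (X (0, i) - X (1, i) : MvPolynomial (Fin 3 × Fin N) ℝ)) '' t)) :
    h ∈ Ideal.span
      ((fun i => (X (0, i) - X (1, i) : MvPolynomial (Fin 3 × Fin N) ℝ)) '' t) := by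
  let ρ : MvPolynomial (Fin 3 × Fin N) ℝ →ₐ[ℝ] MvPolynomial (Fin 3 × Fin N) ℝ :=
    aeval fun q => if q.1 = 0 ∧ q.2 ∈ t then X (1, q.2) else X q
  have hker : Ideal.span
      ((fun i => (X (0, i) - X (1, i) : MvPolynomial (Fin 3 × Fin N) ℝ)) '' t) ≤
      RingHom.ker ρ := by
    refine Ideal.span_le.mpr ?_
    rintro _ ⟨i, hi, rfl⟩
    have hi' : i ∈ t := hi
    simp [ρ, hi']
  have hzero : ρ h = 0 := by
    have h₁ : ρ ((X (0, p) - X (1, p)) * h) = 0 := hker hh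
    rw [map_mul] at h₁
    refine (mul_eq_zero.mp h₁).resolve_left ?_
    simp only [ρ, map_sub, aeval_X, hp, and_false, if_false, one_ne_zero]
    rw [sub_eq_zero]
    intro h
    simpa using X_injective h
  have hsub := sub_algHom_mem ρ (V := Ideal.span
    ((fun i => (X (0, i) - X (1, i) : MvPolynomial (Fin 3 × Fin N) ℝ)) '' t)) (fun ⟨m, i⟩ => by
      by_cases hi : m = 0 ∧ i ∈ t
      · obtain ⟨rfl, hi⟩ := hi
        simp only [ρ, aeval_X, hi, and_self, if_true]
        exact Ideal.subset_span ⟨i, hi, rfl⟩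
      · simp [ρ, hi]) h
  simpa [hzero] using hsub

theorem restrictPos_mem {N : ℕ} {ε : Fin N → ℝ} (hε : ∀ i, ε i = 1 ∨ ε i = -1)
    {f : MvPolynomial (Fin 3 × Fin N) ℝ} (hf : ∀ m, f ∈ signedIdeal ε m)
    (Q : Ideal (MvPolynomial (Fin 3 × Fin N) ℝ))
    (hT : signedIdeal ε 2 * signedIdeal ε 0 * signedIdeal ε 1 ≤ Q)
    (hP : ∀ i j, ε i = 1 → ε j = 1 →
      signedForm ε 2 i * signedForm ε 0 j - signedForm ε 2 j * signedForm ε 0 i ∈ Q) :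
    restrictPos ε f ∈ Q := by
  let γ : MvPolynomial (Fin 3 × Fin N) ℝ →ₐ[ℝ] MvPolynomial (Fin 3 × Fin N) ℝ :=
    aeval fun q => if q.1 = 2 then C (ε q.2) * X (0, q.2) else X q
  have hγ : ∀ f, f - γ f ∈ signedIdeal ε 1 := by
    refine sub_algHom_mem γ fun ⟨m, i⟩ => ?_
    by_cases hm : m = 2
    · subst hm
      simpa [γ, signedForm] using signedForm_mem ε 1 i
    · simp [γ, hm]
  have hmem := signedIdeal_inf_le_mul hε 1 (hf _) (hf _)
  change f ∈ signedIdeal ε 2 * Ideal.span (Set.range (signedForm ε 0)) at hmem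
  rw [← smul_eq_mul] at hmem
  obtain ⟨G, hG, hGf⟩ := (Submodule.mem_ideal_smul_span_iff_exists_sum _ _ _).mp hmem
  rw [Finsupp.sum_fintype _ _ (by simp)] at hGf
  simp only [smul_eq_mul] at hGf
  set s : Finset (Fin N) := Finset.univ.filter fun i => ε i = 1 with hs
  have hposf : restrictPos ε f = ∑ j ∈ s, signedForm ε 0 j * restrictPos ε (G j) := by
    rw [← hGf, map_sum, hs, Finset.sum_filter]
    refine Finset.sum_congr rfl fun j _ => ?_
    rw [map_mul, restrictPos_signedForm]
    split_ifs <;> ring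
  have hposI : ∀ m, ∀ g ∈ signedIdeal ε m, restrictPos ε g ∈ signedIdeal ε m := by
    intro m g hg
    rw [← killNeg_comp_eq_restrictPos hε]
    exact killNeg_mem hε _ _ (killNeg_mem hε _ _ (killNeg_mem hε _ _ hg))
  have hγ₁ : signedIdeal ε 1 ≤ RingHom.ker γ := by
    refine Ideal.span_le.mpr ?_
    rintro _ ⟨i, rfl⟩
    simp [γ, signedForm]
  have hsyz : ∑ j ∈ s, (X (0, j) - X (1, j)) * γ (restrictPos ε (G j)) = 0 := by
    have h₀ : γ (restrictPos ε f) = 0 := hγ₁ (hposI 1 f (hf 1))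
    rw [hposf, map_sum] at h₀
    rw [← neg_eq_zero, ← h₀, ← Finset.sum_neg_distrib]
    refine Finset.sum_congr rfl fun j hj => ?_
    have hj' : ε j = 1 := (Finset.mem_filter.mp hj).2
    have h : γ (signedForm ε 0 j) = X (1, j) - X (0, j) := by simp [γ, signedForm, hj']
    rw [map_mul, h]
    ring
  have hmain := Ideal.sum_mul_mem_of_syzygy _ (signedForm ε 0) Q s (fun i hi j hj => by
    have hi' : ε i = 1 := (Finset.mem_filter.mp hi).2
    have hj' : ε j = 1 := (Finset.mem_filter.mp hj).2
    simpa [signedForm, hi', hj'] using hP i j hi' hj') X_sub_X_regular _ hsyz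
  have hdiff : restrictPos ε f - ∑ j ∈ s, signedForm ε 0 j * γ (restrictPos ε (G j)) ∈ Q := by
    rw [hposf, ← Finset.sum_sub_distrib]
    refine Submodule.sum_mem _ fun j _ => hT ?_
    rw [← mul_sub, mul_comm (signedIdeal ε 2), mul_assoc]
    refine Ideal.mul_mem_mul (signedForm_mem ε 0 j) ?_
    refine Ideal.sub_map_mem_span_mul γ.toRingHom hγ ?_ (hposI 2 _ (hG j))
    rintro _ ⟨i, rfl⟩
    simp [γ, signedForm]
  simpa using add_mem hdiff hmain

/-- The ideal generated by
`{T_ε^{ijk} = (x_i - ε_i y_i)(y_j - ε_j z_j)(z_k - ε_k x_k) : 1 ≤ i,j,k ≤ N}`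
together with
`{P^{ij} = (z_i - x_i)(x_j - y_j) - (z_j - x_j)(x_i - y_i) : ε_i = ε_j = 1}`
equals the intersection `I_ε^x ∩ I_ε^y ∩ I_ε^z`. Variables are encoded by
`Fin 3 × Fin N`, `(0,i) ↦ x_i`, `(1,i) ↦ y_i`, `(2,i) ↦ z_i`. -/
theorem stmt_7 (N : ℕ) (hN : 0 < N) (ε : Fin N → ℝ) (hε : ∀ i, ε i = 1 ∨ ε i = -1) :
    Ideal.span
        ({q : MvPolynomial (Fin 3 × Fin N) ℝ | ∃ i j k : Fin N,
            q = (X (0, i) - C (ε i) * X (1, i)) * (X (1, j) - C (ε j) * X (2, j)) *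
              (X (2, k) - C (ε k) * X (0, k))} ∪
         {q : MvPolynomial (Fin 3 × Fin N) ℝ | ∃ i j : Fin N, ε i = 1 ∧ ε j = 1 ∧
            q = (X (2, i) - X (0, i)) * (X (0, j) - X (1, j)) -
              (X (2, j) - X (0, j)) * (X (0, i) - X (1, i))}) =
      Ideal.span {q : MvPolynomial (Fin 3 × Fin N) ℝ |
          ∃ i : Fin N, q = X (1, i) - C (ε i) * X (2, i)} ⊓
      Ideal.span {q : MvPolynomial (Fin 3 × Fin N) ℝ |
          ∃ i : Fin N, q = X (2, i) - C (ε i) * X (0, i)} ⊓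
      Ideal.span {q : MvPolynomial (Fin 3 × Fin N) ℝ |
          ∃ i : Fin N, q = X (0, i) - C (ε i) * X (1, i)} := by
  have hI : ∀ l : Fin 3, Ideal.span {q : MvPolynomial (Fin 3 × Fin N) ℝ |
      ∃ i : Fin N, q = X (l + 1, i) - C (ε i) * X (l + 2, i)} = signedIdeal ε l := fun l =>
    congrArg Ideal.span (Set.ext fun q => exists_congr fun i => eq_comm)
  have h0 := hI 0
  have h1 := hI 1
  have h2 := hI 2
  simp only [Fin.isValue, Fin.reduceAdd] at h0 h1 h2
  rw [h0, h1, h2]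
  apply le_antisymm
  · refine Ideal.span_le.mpr ?_
    rintro _ (⟨i, j, k, rfl⟩ | ⟨i, j, hi, hj, rfl⟩)
    · refine ⟨⟨?_, ?_⟩, ?_⟩
      · exact Ideal.mul_mem_right _ _ (Ideal.mul_mem_left _ _ (signedForm_mem ε 0 j))
      · exact Ideal.mul_mem_left _ _ (signedForm_mem ε 1 k)
      · exact Ideal.mul_mem_right _ _ (Ideal.mul_mem_right _ _ (signedForm_mem ε 2 i))
    · have hmem : ∀ l, (X (l + 1, i) - X (l + 2, i) : MvPolynomial (Fin 3 × Fin N) ℝ) ∈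
          signedIdeal ε l ∧ (X (l + 1, j) - X (l + 2, j) : MvPolynomial (Fin 3 × Fin N) ℝ) ∈
          signedIdeal ε l := fun l =>
        ⟨by simpa [signedForm, hi] using signedForm_mem ε l i,
          by simpa [signedForm, hj] using signedForm_mem ε l j⟩
      refine ⟨⟨?_, ?_⟩, ?_⟩
      · have h : ((X (2, i) - X (0, i)) * (X (0, j) - X (1, j)) -
            (X (2, j) - X (0, j)) * (X (0, i) - X (1, i)) :
            MvPolynomial (Fin 3 × Fin N) ℝ) =
            (X (0, i) - X (1, i)) * (X (1, j) - X (2, j)) -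
            (X (0, j) - X (1, j)) * (X (1, i) - X (2, i)) := by ring
        rw [h]
        exact sub_mem (Ideal.mul_mem_left _ _ (hmem 0).2) (Ideal.mul_mem_left _ _ (hmem 0).1)
      · exact sub_mem (Ideal.mul_mem_right _ _ (hmem 1).1) (Ideal.mul_mem_right _ _ (hmem 1).2)
      · exact sub_mem (Ideal.mul_mem_left _ _ (hmem 2).2) (Ideal.mul_mem_left _ _ (hmem 2).1)
  · rintro f ⟨⟨hf0, hf1⟩, hf2⟩
    have hf : ∀ m, f ∈ signedIdeal ε m := by
      intro m
      fin_cases m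
      exacts [hf0, hf1, hf2]
    set Q : Ideal (MvPolynomial (Fin 3 × Fin N) ℝ) := Ideal.span (_ ∪ _)
    have hT : signedIdeal ε 2 * signedIdeal ε 0 * signedIdeal ε 1 ≤ Q := by
      rw [signedIdeal, signedIdeal, signedIdeal, Ideal.span_mul_span', Ideal.span_mul_span']
      refine Ideal.span_mono ?_
      rintro _ ⟨_, ⟨_, ⟨i, rfl⟩, _, ⟨j, rfl⟩, rfl⟩, _, ⟨k, rfl⟩, rfl⟩
      exact Or.inl ⟨i, j, k, rfl⟩
    have hP : ∀ i j, ε i = 1 → ε j = 1 →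
        signedForm ε 2 i * signedForm ε 0 j - signedForm ε 2 j * signedForm ε 0 i ∈ Q := by
      intro i j hi hj
      refine Ideal.subset_span (Or.inr ⟨i, j, hi, hj, ?_⟩)
      simp only [signedForm, hi, hj, C_1, Fin.isValue, Fin.reduceAdd]
      ring
    simpa using add_mem (hT (sub_restrictPos_mem hε hf)) (restrictPos_mem hε hf Q hT hP)
end

section
/- Let A_1, A_2 be symmetric positive definite real n×n matrices and let B be a skew-symmetric real n×n matrix (Bᵀ = −B) satisfying the two equations A_1 A_2⁻¹ = A_2 A_1⁻¹ + B A_1⁻¹ B A_2⁻¹ and B A_1⁻¹ B A_2⁻¹ = − B A_2⁻¹ B A_1⁻¹. Then B = 0 and A_1 = A_2. -/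
open Matrix
open scoped MatrixOrder Matrix.Norms.L2Operator in
theorem Matrix.PosDef.exists_isUnit_eq_conjTranspose_mul_self {ι : Type*} [Fintype ι]
    [DecidableEq ι] {M : Matrix ι ι ℝ} (hM : M.PosDef) :
    ∃ C : Matrix ι ι ℝ, IsUnit C ∧ M = Cᴴ * C :=
  CStarAlgebra.isStrictlyPositive_iff_eq_star_mul_self.mp hM.isStrictlyPositive

/-- The form `X ↦ tr (X M Xᴴ N)` is anisotropic when `M` and `N` are positive definite. -/
theorem Matrix.PosDef.eq_zero_of_trace_mul_eq_zero {ι : Type*} [Fintype ι] [DecidableEq ι]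
    {M N X : Matrix ι ι ℝ} (hM : M.PosDef) (hN : N.PosDef)
    (h : (X * M * Xᴴ * N).trace = 0) : X = 0 := by
  obtain ⟨E, hE, rfl⟩ := hM.exists_isUnit_eq_conjTranspose_mul_self
  obtain ⟨C, hC, rfl⟩ := hN.exists_isUnit_eq_conjTranspose_mul_self
  have key : ((C * X * Eᴴ) * (C * X * Eᴴ)ᴴ).trace = 0 := by
    rw [← h, ← Matrix.mul_assoc _ Cᴴ C, Matrix.trace_mul_comm _ C]
    simp only [conjTranspose_mul, conjTranspose_conjTranspose, Matrix.mul_assoc]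
  rw [trace_mul_conjTranspose_self_eq_zero_iff] at key
  have hE' : IsUnit Eᴴ := hE.star
  rwa [hE'.mul_left_eq_zero, hC.mul_right_eq_zero] at key

/-- Let `A₁, A₂` be symmetric positive definite real `n × n`
matrices and `B` a skew-symmetric real `n × n` matrix satisfying
`A₁ A₂⁻¹ = A₂ A₁⁻¹ + B A₁⁻¹ B A₂⁻¹` and `B A₁⁻¹ B A₂⁻¹ = -(B A₂⁻¹ B A₁⁻¹)`.
Then `B = 0` and `A₁ = A₂`. -/
theorem stmt_8 (n : ℕ) (hn : 0 < n) (A₁ A₂ B : Matrix (Fin n) (Fin n) ℝ)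
    (hA₁sym : A₁.IsSymm) (hA₂sym : A₂.IsSymm)
    (hA₁ : A₁.PosDef) (hA₂ : A₂.PosDef)
    (hB : Bᵀ = -B)
    (h1 : A₁ * A₂⁻¹ = A₂ * A₁⁻¹ + B * A₁⁻¹ * B * A₂⁻¹)
    (h2 : B * A₁⁻¹ * B * A₂⁻¹ = -(B * A₂⁻¹ * B * A₁⁻¹)) :
    B = 0 ∧ A₁ = A₂ := by
  have hP := hA₁.inv
  have hQ := hA₂.inv
  have hB0 : B = 0 := by
    refine hP.eq_zero_of_trace_mul_eq_zero hQ ?_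
    have hcyc : (B * A₂⁻¹ * B * A₁⁻¹).trace = (B * A₁⁻¹ * B * A₂⁻¹).trace := by
      rw [Matrix.mul_assoc (B * A₂⁻¹), Matrix.trace_mul_comm, ← Matrix.mul_assoc]
    have htr := congrArg Matrix.trace h2
    rw [Matrix.trace_neg, hcyc] at htr
    rw [conjTranspose_eq_transpose_of_trivial, hB, Matrix.mul_neg, Matrix.neg_mul,
      Matrix.trace_neg]
    linarith
  refine ⟨hB0, ?_⟩
  have hdet₁ : IsUnit A₁.det := (Matrix.isUnit_iff_isUnit_det _).mp hA₁.isUnit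
  have hdet₂ : IsUnit A₂.det := (Matrix.isUnit_iff_isUnit_det _).mp hA₂.isUnit
  have hAA : A₁ * A₂⁻¹ = A₂ * A₁⁻¹ := by simpa [hB0] using h1
  have hQA : A₁ * A₂⁻¹ * A₁ = A₂ := by
    rw [hAA, Matrix.mul_assoc, Matrix.nonsing_inv_mul _ hdet₁, Matrix.mul_one]
  have hPA : A₂ * A₁⁻¹ * A₂ = A₁ := by
    rw [← hAA, Matrix.mul_assoc, Matrix.nonsing_inv_mul _ hdet₂, Matrix.mul_one]
  have hD : (A₁ - A₂) * (A₁⁻¹ + A₂⁻¹) * (A₁ - A₂) = 0 := by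
    simp only [Matrix.sub_mul, Matrix.mul_sub, Matrix.mul_add, Matrix.add_mul, hQA, hPA,
      Matrix.mul_nonsing_inv _ hdet₁, Matrix.mul_nonsing_inv _ hdet₂, Matrix.one_mul]
    simp only [Matrix.mul_assoc, Matrix.nonsing_inv_mul _ hdet₁,
      Matrix.nonsing_inv_mul _ hdet₂, Matrix.mul_one]
    abel
  refine sub_eq_zero.mp ((hP.add hQ).eq_zero_of_trace_mul_eq_zero PosDef.one ?_)
  rw [(hA₁.isHermitian.sub hA₂.isHermitian).eq, hD, Matrix.zero_mul, Matrix.trace_zero]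
end

section
/- (Gröbner Squeeze Theorem) Let g_1, …, g_n be nonzero elements of S contained in an intersection of ideals I_1 ∩ ⋯ ∩ I_r of S, and suppose there are ideals J_1, …, J_m of S such that I_1 ∩ ⋯ ∩ I_r ⊆ J_1 ∩ ⋯ ∩ J_m and the ideal generated by the leading monomials of g_1, …, g_n equals the intersection of the initial ideals in_<(J_1) ∩ ⋯ ∩ in_<(J_m). Then the ideal generated by g_1, …, g_n equals I_1 ∩ ⋯ ∩ I_r, and the initial ideal in_<(I_1 ∩ ⋯ ∩ I_r) is generated by the leading monomials of g_1, …, g_n (i.e. {g_1,…,g_n} is a Gröbner basis of I_1 ∩ ⋯ ∩ I_r with respect to <). -/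
open MvPolynomial

variable {σ : Type*} {k : Type*} [Field k]

/-- The multidegree (exponent of the leading monomial) of a multivariate
polynomial with respect to a monomial order: the `m`-largest exponent appearing
in the support of `f` (and `0` if `f = 0`). -/
noncomputable def mDegree (m : MonomialOrder σ) (f : MvPolynomial σ k) : σ →₀ ℕ :=
  m.toSyn.symm (f.support.sup m.toSyn)

/-- The initial ideal of an ideal `I` of a polynomial ring with respect to a
monomial order `m`: the ideal generated by the leading monomials of the nonzero
elements of `I`. -/
noncomputable def initialIdeal (m : MonomialOrder σ) (I : Ideal (MvPolynomial σ k)) :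
    Ideal (MvPolynomial σ k) :=
  Ideal.span {g | ∃ f ∈ I, f ≠ 0 ∧ g = monomial (mDegree m f) (1 : k)}

theorem monomial_mDegree_mem_initialIdeal (m : MonomialOrder σ) {I : Ideal (MvPolynomial σ k)}
    {f : MvPolynomial σ k} (hf : f ∈ I) (hf0 : f ≠ 0) :
    monomial (mDegree m f) (1 : k) ∈ initialIdeal m I :=
  Ideal.subset_span ⟨f, hf, hf0, rfl⟩

theorem initialIdeal_mono (m : MonomialOrder σ) : Monotone (initialIdeal (k := k) m) :=
  fun _ _ h => Ideal.span_mono fun _ ⟨f, hf, hf0, hq⟩ => ⟨f, h hf, hf0, hq⟩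

/-- A family of nonzero elements of `I` whose leading monomials generate an ideal containing
the initial ideal of `I` generates `I`. -/
theorem span_range_eq_of_initialIdeal_le (m : MonomialOrder σ) {ι : Type*}
    {g : ι → MvPolynomial σ k} (hg : ∀ t, g t ≠ 0) {I : Ideal (MvPolynomial σ k)}
    (hgI : ∀ t, g t ∈ I)
    (h : initialIdeal m I ≤
      Ideal.span {q : MvPolynomial σ k | ∃ t, q = monomial (mDegree m (g t)) (1 : k)}) :
    Ideal.span (Set.range g) = I := by
  have hle : Ideal.span (Set.range g) ≤ I := Ideal.span_le.2 (Set.range_subset_iff.2 hgI)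
  refine le_antisymm hle fun f hf => ?_
  obtain ⟨c, r, hfr, -, hr⟩ := m.div (b := g)
    (fun t => (m.leadingCoeff_ne_zero_iff.2 (hg t)).isUnit) f
  have hc : Finsupp.linearCombination _ g c ∈ Ideal.span (Set.range g) :=
    Finsupp.mem_ideal_span_range_iff_exists_finsupp.2 ⟨c, rfl⟩
  suffices hr0 : r = 0 by rwa [hfr, hr0, add_zero]
  by_contra hr0
  have hrI : r ∈ I := (I.add_mem_iff_right (hle hc)).1 (hfr ▸ hf)
  have hlead := h (monomial_mDegree_mem_initialIdeal m hrI hr0)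
  have hset : {q : MvPolynomial σ k | ∃ t, q = monomial (mDegree m (g t)) (1 : k)} =
      (fun d => monomial d (1 : k)) '' Set.range fun t => mDegree m (g t) := by
    ext q
    simp [eq_comm]
  rw [hset, mem_ideal_span_monomial_image] at hlead
  obtain ⟨_, ⟨t, rfl⟩, ht⟩ := hlead (mDegree m r) (by classical simp [coeff_monomial])
  exact hr _ (m.degree_mem_support hr0) t ht

/-- **Gröbner Squeeze Theorem.** Let `g_1, …, g_n` be nonzero
polynomials contained in `I_1 ∩ ⋯ ∩ I_r`, and suppose ideals `J_1, …, J_m`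
satisfy `I_1 ∩ ⋯ ∩ I_r ⊆ J_1 ∩ ⋯ ∩ J_m` and the ideal generated by the leading
monomials of the `g_t` equals `in(J_1) ∩ ⋯ ∩ in(J_m)`. Then
`⟨g_1,…,g_n⟩ = I_1 ∩ ⋯ ∩ I_r` and the leading monomials of the `g_t` generate
`in(I_1 ∩ ⋯ ∩ I_r)`, i.e. `{g_1,…,g_n}` is a Gröbner basis of
`I_1 ∩ ⋯ ∩ I_r`. -/
theorem stmt_10 [Finite σ] (m : MonomialOrder σ)
    (n r s : ℕ) (hn : 0 < n) (hr : 0 < r) (hs : 0 < s)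
    (g : Fin n → MvPolynomial σ k) (hg : ∀ t, g t ≠ 0)
    (I : Fin r → Ideal (MvPolynomial σ k)) (J : Fin s → Ideal (MvPolynomial σ k))
    (hgI : ∀ t, g t ∈ ⨅ i, I i)
    (hIJ : (⨅ i, I i) ≤ ⨅ j, J j)
    (hlead : Ideal.span {q : MvPolynomial σ k | ∃ t, q = monomial (mDegree m (g t)) (1 : k)} =
      ⨅ j, initialIdeal m (J j)) :
    Ideal.span (Set.range g) = (⨅ i, I i) ∧
      initialIdeal m (⨅ i, I i) =
        Ideal.span {q : MvPolynomial σ k | ∃ t, q = monomial (mDegree m (g t)) (1 : k)} := by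
  have hle : initialIdeal m (⨅ i, I i) ≤
      Ideal.span {q : MvPolynomial σ k | ∃ t, q = monomial (mDegree m (g t)) (1 : k)} :=
    hlead ▸ le_iInf fun j => initialIdeal_mono m (hIJ.trans (iInf_le J j))
  refine ⟨span_range_eq_of_initialIdeal_le m hg hgI hle, le_antisymm hle (Ideal.span_le.2 ?_)⟩
  rintro _ ⟨t, rfl⟩
  exact monomial_mDegree_mem_initialIdeal m (hgI t) (hg t)
end

section
/- In R, the intersection of monomial ideals ⟨x_i y_j : 1 ≤ i,j ≤ N⟩ ∩ (⟨x_i x_j : 1 ≤ i,j ≤ N⟩ + ⟨x_k y_ℓ : 1 ≤ k < ℓ ≤ N⟩) equals the monomial ideal ⟨x_i x_j y_k : 1 ≤ i,j,k ≤ N with k ≤ i and k ≤ j⟩ + ⟨x_ℓ y_m : 1 ≤ ℓ < m ≤ N⟩. -/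
open MvPolynomial

namespace MvPolynomial

variable {σ R : Type*} [CommSemiring R]

/-- Monomial ideals are compared on monomials: if every exponent dominating both an exponent of `s`
and an exponent of `t` also dominates an exponent of `u`, then the intersection of the ideals
generated by `s` and `t` lies in the ideal generated by `u`. -/
theorem span_monomial_image_inf_le {s t u : Set (σ →₀ ℕ)}
    (h : ∀ m, ∀ a ∈ s, ∀ b ∈ t, a ≤ m → b ≤ m → ∃ c ∈ u, c ≤ m) :
    Ideal.span ((fun e ↦ monomial e (1 : R)) '' s) ⊓
        Ideal.span ((fun e ↦ monomial e (1 : R)) '' t) ≤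
      Ideal.span ((fun e ↦ monomial e (1 : R)) '' u) := by
  rintro p ⟨hs, ht⟩
  refine mem_ideal_span_monomial_image.2 fun m hm ↦ ?_
  obtain ⟨a, ha, ham⟩ := mem_ideal_span_monomial_image.1 hs m hm
  obtain ⟨b, hb, hbm⟩ := mem_ideal_span_monomial_image.1 ht m hm
  exact h m a ha b hb ham hbm

theorem X_mul_X_eq_monomial (a b : σ) :
    (X a * X b : MvPolynomial σ R) =
      monomial (Finsupp.single a 1 + Finsupp.single b 1) 1 := by
  simp [X, monomial_mul]

theorem X_mul_X_mul_X_eq_monomial (a b c : σ) :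
    (X a * X b * X c : MvPolynomial σ R) =
      monomial (Finsupp.single a 1 + Finsupp.single b 1 + Finsupp.single c 1) 1 := by
  simp [X, monomial_mul]

end MvPolynomial

theorem Finsupp.single_add_single_le_iff_of_ne {σ : Type*} {a b : σ} (hab : a ≠ b)
    (m : σ →₀ ℕ) : single a 1 + single b 1 ≤ m ↔ 1 ≤ m a ∧ 1 ≤ m b := by
  classical
  refine ⟨fun h ↦ ⟨?_, ?_⟩, fun ⟨ha, hb⟩ i ↦ ?_⟩
  · simpa [hab, hab.symm] using h a
  · simpa [hab, hab.symm] using h b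
  · simp only [coe_add, Pi.add_apply, single_apply]
    grind

/-- In `R = ℝ[x_1,…,x_N,y_1,…,y_N,z_1,…,z_N]` (variables
encoded by `Fin 3 × Fin N`, `(0,i) ↦ x_i`, `(1,i) ↦ y_i`, `(2,i) ↦ z_i`), the
intersection of monomial ideals
`⟨x_i y_j : 1 ≤ i,j ≤ N⟩ ∩ (⟨x_i x_j : 1 ≤ i,j ≤ N⟩ + ⟨x_k y_ℓ : k < ℓ⟩)`
equals `⟨x_i x_j y_k : k ≤ i, k ≤ j⟩ + ⟨x_ℓ y_m : ℓ < m⟩`. -/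
theorem stmt_12 (N : ℕ) (hN : 0 < N) :
    (Ideal.span {q : MvPolynomial (Fin 3 × Fin N) ℝ |
          ∃ i j : Fin N, q = X (0, i) * X (1, j)}) ⊓
      (Ideal.span {q : MvPolynomial (Fin 3 × Fin N) ℝ |
          ∃ i j : Fin N, q = X (0, i) * X (0, j)} ⊔
        Ideal.span {q : MvPolynomial (Fin 3 × Fin N) ℝ |
          ∃ k l : Fin N, k < l ∧ q = X (0, k) * X (1, l)}) =
    Ideal.span {q : MvPolynomial (Fin 3 × Fin N) ℝ |
        ∃ i j k : Fin N, k ≤ i ∧ k ≤ j ∧ q = X (0, i) * X (0, j) * X (1, k)} ⊔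
      Ideal.span {q : MvPolynomial (Fin 3 × Fin N) ℝ |
        ∃ l m : Fin N, l < m ∧ q = X (0, l) * X (1, m)} := by
  apply le_antisymm
  · have hsq : {q : MvPolynomial (Fin 3 × Fin N) ℝ | ∃ i j : Fin N, q = X (0, i) * X (1, j)} =
        (fun e ↦ monomial e 1) '' {e | ∃ i j : Fin N,
          e = Finsupp.single (0, i) 1 + Finsupp.single (1, j) 1} := by
      ext q
      simp only [X_mul_X_eq_monomial, Set.mem_ofPred_eq, Set.mem_image]
      grind
    have hsum : {q : MvPolynomial (Fin 3 × Fin N) ℝ | ∃ i j : Fin N, q = X (0, i) * X (0, j)} ∪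
          {q | ∃ k l : Fin N, k < l ∧ q = X (0, k) * X (1, l)} =
        (fun e ↦ monomial e 1) ''
          ({e | ∃ i j : Fin N, e = Finsupp.single (0, i) 1 + Finsupp.single (0, j) 1} ∪
            {e | ∃ k l : Fin N, k < l ∧
              e = Finsupp.single (0, k) 1 + Finsupp.single (1, l) 1}) := by
      ext q
      simp only [X_mul_X_eq_monomial, Set.mem_ofPred_eq, Set.mem_image, Set.mem_union]
      grind
    have htarget : {q : MvPolynomial (Fin 3 × Fin N) ℝ | ∃ i j k : Fin N,
            k ≤ i ∧ k ≤ j ∧ q = X (0, i) * X (0, j) * X (1, k)} ∪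
          {q | ∃ l m : Fin N, l < m ∧ q = X (0, l) * X (1, m)} =
        (fun e ↦ monomial e 1) ''
          ({e | ∃ i j k : Fin N, k ≤ i ∧ k ≤ j ∧ e = Finsupp.single (0, i) 1 +
              Finsupp.single (0, j) 1 + Finsupp.single (1, k) 1} ∪
            {e | ∃ l m : Fin N, l < m ∧
              e = Finsupp.single (0, l) 1 + Finsupp.single (1, m) 1}) := by
      ext q
      simp only [X_mul_X_mul_X_eq_monomial]
      simp only [X_mul_X_eq_monomial, Set.mem_ofPred_eq, Set.mem_image, Set.mem_union]
      grind
    rw [← Ideal.span_union, ← Ideal.span_union, hsq, hsum, htarget]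
    refine span_monomial_image_inf_le ?_
    rintro m _ ⟨i, j, rfl⟩ _ (⟨a, b, rfl⟩ | ⟨k, l, hkl, rfl⟩) hij hm
    · have hj : 1 ≤ m (1, j) := ((Finsupp.single_add_single_le_iff_of_ne (by simp) m).1 hij).2
      have ha : 1 ≤ m (0, a) := by simpa using (le_self_add.trans hm) (0, a)
      have hb : 1 ≤ m (0, b) := by simpa using (le_add_self.trans hm) (0, b)
      rcases lt_or_ge a j with haj | hja
      · exact ⟨_, Or.inr ⟨a, j, haj, rfl⟩,
          (Finsupp.single_add_single_le_iff_of_ne (by simp) m).2 ⟨ha, hj⟩⟩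
      rcases lt_or_ge b j with hbj | hjb
      · exact ⟨_, Or.inr ⟨b, j, hbj, rfl⟩,
          (Finsupp.single_add_single_le_iff_of_ne (by simp) m).2 ⟨hb, hj⟩⟩
      refine ⟨_, Or.inl ⟨a, b, j, hja, hjb, rfl⟩, fun v ↦ ?_⟩
      have hv := hm v
      simp only [Finsupp.coe_add, Pi.add_apply, Finsupp.single_apply] at hv ⊢
      grind
    · exact ⟨_, Or.inr ⟨k, l, hkl, rfl⟩, hm⟩
  · refine sup_le (Ideal.span_le.2 ?_) (Ideal.span_le.2 ?_)
    · rintro _ ⟨i, j, k, -, -, rfl⟩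
      refine ⟨?_, Ideal.mem_sup_left
        (Ideal.mul_mem_right _ _ (Ideal.subset_span ⟨i, j, rfl⟩))⟩
      rw [mul_right_comm]
      exact Ideal.mul_mem_right _ _ (Ideal.subset_span ⟨i, k, rfl⟩)
    · rintro _ ⟨l, m, hlm, rfl⟩
      exact ⟨Ideal.subset_span ⟨l, m, rfl⟩,
        Ideal.mem_sup_right (Ideal.subset_span ⟨l, m, hlm, rfl⟩)⟩
end
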